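/- For n ≥ 3, the polynomial g(x) = xₙ³ + (3/2)xₙ(x₁² + … + x_{n−2}² − 2x_{n−1}²) + (3√3/2)x_{n−1}(x₁² + … + x_{n−2}²) on ℝⁿ satisfies the eiconal equation |∇g(x)|² = 9|x|⁴ for all x, and g is rotationally equivalent to xₙ³ − 3xₙ(x₁² + … + x_{n−1}²). -/

import Mathlib

open MvPolynomial

/-- The polynomial `xₙ³ + (3/2)xₙ(x₁² + ⋯ + x_{n−2}² − 2x_{n−1}²)
    + (3√3/2)x_{n−1}(x₁² + ⋯ + x_{n−2}²)`. -/
noncomputable def rotatedCubic (n : ℕ) (hn : 3 ≤ n) : MvPolynomial (Fin n) ℝ :=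
  X (⟨n - 1, by omega⟩ : Fin n) ^ 3 +
    C ((3 : ℝ) / 2) * X (⟨n - 1, by omega⟩ : Fin n) *
      (∑ i : Fin (n - 2), X (⟨i.1, by omega⟩ : Fin n) ^ 2 -
        2 * X (⟨n - 2, by omega⟩ : Fin n) ^ 2) +
    C (3 * Real.sqrt 3 / 2) * X (⟨n - 2, by omega⟩ : Fin n) *
      ∑ i : Fin (n - 2), X (⟨i.1, by omega⟩ : Fin n) ^ 2

/-- The polynomial `xₙ³ − 3xₙ(x₁² + ⋯ + x_{n−1}²)`. -/
noncomputable def simpleCubic (n : ℕ) (hn : 3 ≤ n) : MvPolynomial (Fin n) ℝ :=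
  X (⟨n - 1, by omega⟩ : Fin n) ^ 3 -
    3 * X (⟨n - 1, by omega⟩ : Fin n) *
      ∑ i : Fin (n - 1), X (⟨i.1, by omega⟩ : Fin n) ^ 2

open Matrix in
/-- The Householder reflection in a unit vector is orthogonal. -/
theorem one_sub_two_smul_vecMulVec_mem_orthogonalGroup {ι : Type*} [Fintype ι] [DecidableEq ι]
    {v : ι → ℝ} (hv : v ⬝ᵥ v = 1) :
    (1 - (2 : ℝ) • vecMulVec v v) ∈ orthogonalGroup ι ℝ := by
  have hT : (vecMulVec v v)ᵀ = vecMulVec v v := transpose_vecMulVec v v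
  have hP : vecMulVec v v * vecMulVec v v = vecMulVec v v := by
    rw [vecMulVec_mul_vecMulVec, hv, one_smul]
  rw [mem_orthogonalGroup_iff, transpose_sub, transpose_one, transpose_smul, hT]
  simp only [sub_mul, mul_sub, one_mul, mul_one, smul_mul_assoc, mul_smul_comm, hP]
  module

theorem rotatedCubic_add_two (m : ℕ) (hm : 3 ≤ m + 2) :
    rotatedCubic (m + 2) hm =
      X (Fin.last (m + 1)) ^ 3 + C ((3 : ℝ) / 2) * X (Fin.last (m + 1)) *
        (∑ i : Fin m, X i.castSucc.castSucc ^ 2 - 2 * X (Fin.last m).castSucc ^ 2) +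
      C (3 * √3 / 2) * X (Fin.last m).castSucc * ∑ i : Fin m, X i.castSucc.castSucc ^ 2 :=
  rfl

theorem simpleCubic_add_two (m : ℕ) (hm : 3 ≤ m + 2) :
    simpleCubic (m + 2) hm =
      X (Fin.last (m + 1)) ^ 3 -
        3 * X (Fin.last (m + 1)) * ∑ i : Fin (m + 1), X i.castSucc ^ 2 :=
  rfl

theorem eval_pderiv_rotatedCubic (m : ℕ) (hm : 3 ≤ m + 2) (x : Fin (m + 2) → ℝ)
    (j : Fin (m + 2)) :
    eval x (pderiv j (rotatedCubic (m + 2) hm)) =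
      (3 * x (Fin.last (m + 1)) ^ 2 + 3 / 2 * (∑ i : Fin m, x i.castSucc.castSucc ^ 2 -
        2 * x (Fin.last m).castSucc ^ 2)) * (Pi.single j 1 : Fin (m + 2) → ℝ) (Fin.last (m + 1)) +
      (3 * √3 / 2 * ∑ i : Fin m, x i.castSucc.castSucc ^ 2 -
        6 * x (Fin.last (m + 1)) * x (Fin.last m).castSucc) *
        (Pi.single j 1 : Fin (m + 2) → ℝ) (Fin.last m).castSucc +
      (3 * x (Fin.last (m + 1)) + 3 * √3 * x (Fin.last m).castSucc) *
        ∑ i : Fin m, x i.castSucc.castSucc *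
          (Pi.single j 1 : Fin (m + 2) → ℝ) i.castSucc.castSucc := by
  have hX (k : Fin (m + 2)) : eval x (pderiv j (X k : MvPolynomial (Fin (m + 2)) ℝ)) =
      (Pi.single j 1 : Fin (m + 2) → ℝ) k := by
    rw [pderiv_X, Pi.single_apply, Pi.single_apply]
    split_ifs <;> simp_all
  have h2 : pderiv j (2 : MvPolynomial (Fin (m + 2)) ℝ) = 0 := pderiv_C (a := (2 : ℝ))
  have hsum : ∑ i : Fin m, 2 * x i.castSucc.castSucc *
        (Pi.single j 1 : Fin (m + 2) → ℝ) i.castSucc.castSucc =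
      2 * ∑ i : Fin m, x i.castSucc.castSucc *
        (Pi.single j 1 : Fin (m + 2) → ℝ) i.castSucc.castSucc := by
    simp only [Finset.mul_sum, mul_assoc]
  rw [rotatedCubic_add_two]
  simp [-pderiv_X, hX, h2, ← mul_assoc, hsum]
  ring

/-- The eiconal equation for `rotatedCubic`. -/
theorem sum_sq_eval_pderiv_rotatedCubic (m : ℕ) (hm : 3 ≤ m + 2) (x : Fin (m + 2) → ℝ) :
    ∑ i, (eval x (pderiv i (rotatedCubic (m + 2) hm))) ^ 2 = 9 * (∑ i, x i ^ 2) ^ 2 := by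
  have h3 : √3 ^ 2 = 3 := Real.sq_sqrt (by norm_num)
  simp only [eval_pderiv_rotatedCubic, Fin.sum_univ_castSucc]
  simp [Pi.single_apply, Fin.castSucc_ne_last, (Fin.castSucc_ne_last _).symm, mul_pow,
    ← Finset.mul_sum]
  set s := ∑ i : Fin m, x i.castSucc.castSucc ^ 2
  set y := x (Fin.last m).castSucc
  set z := x (Fin.last (m + 1))
  linear_combination (9 / 4 * s ^ 2 + 9 * y ^ 2 * s) * h3

/-- The unit normal of the reflection carrying `simpleCubic` to `rotatedCubic`. -/
noncomputable def cubicNormal (m : ℕ) : Fin (m + 2) → ℝ :=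
  Fin.snoc (Fin.snoc 0 (1 / 2) : Fin (m + 1) → ℝ) (√3 / 2)

theorem cubicNormal_dotProduct (m : ℕ) (x : Fin (m + 2) → ℝ) :
    cubicNormal m ⬝ᵥ x = 1 / 2 * x (Fin.last m).castSucc + √3 / 2 * x (Fin.last (m + 1)) := by
  simp [cubicNormal, dotProduct, Fin.sum_univ_castSucc]

theorem cubicNormal_dotProduct_self (m : ℕ) : cubicNormal m ⬝ᵥ cubicNormal m = 1 := by
  have h3 : √3 ^ 2 = 3 := Real.sq_sqrt (by norm_num)
  rw [cubicNormal_dotProduct]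
  simp only [cubicNormal, Fin.snoc_castSucc, Fin.snoc_last]
  linear_combination h3 / 4

open Matrix in
theorem eval_rotatedCubic_eq_eval_simpleCubic (m : ℕ) (hm : 3 ≤ m + 2) (x : Fin (m + 2) → ℝ) :
    eval x (rotatedCubic (m + 2) hm) =
      eval ((1 - (2 : ℝ) • vecMulVec (cubicNormal m) (cubicNormal m)) *ᵥ x)
        (simpleCubic (m + 2) hm) := by
  have h3 : √3 ^ 2 = 3 := Real.sq_sqrt (by norm_num)
  rw [rotatedCubic_add_two, simpleCubic_add_two]
  simp [Fin.sum_univ_castSucc, sub_mulVec, smul_mulVec, vecMulVec_mulVec,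
    cubicNormal_dotProduct]
  simp [cubicNormal]
  set s := ∑ i : Fin m, x i.castSucc.castSucc ^ 2
  set y := x (Fin.last m).castSucc
  set z := x (Fin.last (m + 1))
  linear_combination (-3 / 2 * z * s + 3 / 8 * z * y ^ 2 * (√3 ^ 2 + 2) + 3 / 8 * √3 ^ 3 * z ^ 2 * y +
    √3 ^ 2 / 8 * (√3 ^ 2 - 6) * z ^ 3 + √3 / 8 * y ^ 3) * h3

/-- For `n ≥ 3`, the polynomial `g(x) = xₙ³ + (3/2)xₙ(x₁² + ⋯ + x_{n−2}² − 2x_{n−1}²)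
    + (3√3/2)x_{n−1}(x₁² + ⋯ + x_{n−2}²)` satisfies the eiconal equation and is
    rotationally equivalent to `xₙ³ − 3xₙ(x₁² + ⋯ + x_{n−1}²)`. -/
theorem rotatedCubic_eiconal_and_equiv (n : ℕ) (hn : 3 ≤ n) :
    (∀ x : Fin n → ℝ,
      ∑ i, (eval x (pderiv i (rotatedCubic n hn))) ^ 2 = 9 * (∑ i, x i ^ 2) ^ 2) ∧
    (∃ U : Matrix (Fin n) (Fin n) ℝ, U ∈ Matrix.orthogonalGroup (Fin n) ℝ ∧
      ∀ x : Fin n → ℝ,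
        eval x (rotatedCubic n hn) = eval (U.mulVec x) (simpleCubic n hn)) := by
  obtain ⟨m, rfl⟩ : ∃ m, n = m + 2 := ⟨n - 2, by omega⟩
  exact ⟨sum_sq_eval_pderiv_rotatedCubic m hn, _,
    one_sub_two_smul_vecMulVec_mem_orthogonalGroup (cubicNormal_dotProduct_self m),
    eval_rotatedCubic_eq_eval_simpleCubic m hn⟩
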